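/- arXiv:2101.12403 — 4 statements merged into one kernel-verified Lean document; each statement's English description precedes it below -/
import Mathlib

section
/- Suppose each C_i satisfies the (ε,δ)-lower deviation inequality and R ≤ (1−ε)Z. Then the mean-weighted allocation v_i = R·μ_i/Z satisfies, for every group i: (v_i/μ_i)(1 − δ) ≤ q(v_i, C_i) ≤ v_i/μ_i ≤ 1 − ε. -/
open MeasureTheory ProbabilityTheory

/-- If `X ≥ 0` is at most `a` with probability at most `δ`, then truncating `X` at a level
`v ≤ a` retains expectation at least `v * (1 - δ)`. -/
theorem mul_one_sub_le_integral_min {Ω : Type*} [MeasurableSpace Ω] {P : Measure Ω}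
    [IsProbabilityMeasure P] {X : Ω → ℝ} (hX : Measurable X) (hint : Integrable X P)
    (hnonneg : ∀ ω, 0 ≤ X ω) {a v δ : ℝ} (hv : 0 ≤ v) (hva : v ≤ a)
    (hδ : P.real {ω | X ω ≤ a} ≤ δ) :
    v * (1 - δ) ≤ ∫ ω, min (X ω) v ∂P := by
  have hS : MeasurableSet {ω | X ω ≤ a} := measurableSet_le hX measurable_const
  calc
    v * (1 - δ) ≤ v * (1 - P.real {ω | X ω ≤ a}) := by gcongr
    _ = ∫ ω, ({ω | X ω ≤ a}ᶜ).indicator (fun _ => v) ω ∂P := by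
      rw [integral_indicator_const v hS.compl, probReal_compl_eq_one_sub hS, smul_eq_mul, mul_comm]
    _ ≤ ∫ ω, min (X ω) v ∂P := by
      refine integral_mono ((integrable_const v).indicator hS.compl)
        (hint.inf (integrable_const v)) fun ω => ?_
      refine Set.indicator_apply_le' (fun hω => ?_) (fun _ => le_min (hnonneg ω) hv)
      have hω : a < X ω := by simpa using hω
      exact le_min (hva.trans hω.le) le_rfl

/-- Truncating an integrable random variable at level `v` leaves an expectation at most `v`. -/
theorem integral_min_const_le {Ω : Type*} [MeasurableSpace Ω] {P : Measure Ω}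
    [IsProbabilityMeasure P] {X : Ω → ℝ} (hint : Integrable X P) (v : ℝ) :
    ∫ ω, min (X ω) v ∂P ≤ v := by
  simpa using integral_mono (hint.inf (integrable_const v)) (integrable_const v)
    fun _ => inf_le_right

/-- If each `C i` satisfies the `(ε,δ)`-lower deviation inequality and
`R ≤ (1-ε) Z`, then the mean-weighted allocation `v i = R * μ i / Z` satisfies, for every `i`,
`(v i / μ i) * (1 - δ) ≤ q (v i) (C i) ≤ v i / μ i ≤ 1 - ε`. -/
theorem meanWeighted_availability_bounds_lowR
    {Ω : Type*} [MeasureSpace Ω] [IsProbabilityMeasure (ℙ : Measure Ω)]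
    {K : ℕ} (hK : 0 < K)
    (C : Fin K → Ω → ℝ)
    (hmeas : ∀ i, Measurable (C i))
    (hint : ∀ i, Integrable (C i))
    (hnonneg : ∀ i, ∀ ω, 0 ≤ C i ω)
    (μ : Fin K → ℝ) (hμ : ∀ i, μ i = ∫ ω, C i ω) (hμpos : ∀ i, 0 < μ i)
    (ε δ : ℝ) (hε0 : 0 < ε) (hε1 : ε < 1) (hδ0 : 0 < δ) (hδ1 : δ < 1)
    (hLD : ∀ i, (ℙ {ω | C i ω ≤ (1 - ε) * μ i}).toReal ≤ δ)
    (R : ℝ) (hR : 0 < R)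
    (Z : ℝ) (hZ : Z = ∑ i, μ i)
    (hRZ : R ≤ (1 - ε) * Z)
    (v : Fin K → ℝ) (hv : ∀ i, v i = R * μ i / Z) :
    ∀ i, (v i / μ i) * (1 - δ) ≤ (∫ ω, min (C i ω) (v i)) / μ i ∧
      (∫ ω, min (C i ω) (v i)) / μ i ≤ v i / μ i ∧
      v i / μ i ≤ 1 - ε := by
  intro i
  have hμi := hμpos i
  have hZpos : 0 < Z := hZ ▸ Finset.sum_pos (fun j _ => hμpos j) ⟨i, Finset.mem_univ i⟩
  have hvμ : v i / μ i = R / Z := by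
    rw [hv i]
    field_simp
  have hv0 : 0 ≤ v i := by
    rw [hv i]
    positivity
  have hratio : v i / μ i ≤ 1 - ε := by
    rwa [hvμ, div_le_iff₀ hZpos]
  refine ⟨?_, ?_, hratio⟩
  · rw [div_mul_eq_mul_div]
    gcongr
    exact mul_one_sub_le_integral_min (hmeas i) (hint i) (hnonneg i) hv0
      ((div_le_iff₀ hμi).1 hratio) (hLD i)
  · gcongr
    exact integral_min_const_le (hint i) (v i)
end

section
/- Suppose each C_i satisfies the (ε,δ)-lower deviation inequality and R ≤ (1−ε)Z. Then the mean-weighted allocation v = (R·μ_1/Z, …, R·μ_K/Z) has utilization U(v) ≥ (1−δ)R. -/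
open MeasureTheory ProbabilityTheory

/-- Truncating a nonnegative random variable at a level `a ≤ t` that it exceeds with probability
at least `1 - δ` keeps a fraction `1 - δ` of that level in expectation. -/
theorem one_sub_mul_le_integral_min {Ω : Type*} [MeasurableSpace Ω] {P : Measure Ω}
    [IsProbabilityMeasure P] {X : Ω → ℝ} (hmeas : Measurable X) (hint : Integrable X P)
    (hnonneg : ∀ ω, 0 ≤ X ω) {a t δ : ℝ} (ha : 0 ≤ a) (hat : a ≤ t)
    (hδ : P.real {ω | X ω ≤ t} ≤ δ) :
    (1 - δ) * a ≤ ∫ ω, min (X ω) a ∂P := by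
  have hs : MeasurableSet {ω | X ω ≤ t} := measurableSet_le hmeas measurable_const
  calc (1 - δ) * a ≤ P.real {ω | X ω ≤ t}ᶜ * a := by
        rw [probReal_compl_eq_one_sub hs]
        gcongr
    _ = ∫ ω, {ω | X ω ≤ t}ᶜ.indicator (fun _ => a) ω ∂P := by
        rw [integral_indicator_const _ hs.compl, smul_eq_mul]
    _ ≤ ∫ ω, min (X ω) a ∂P := by
        refine integral_mono ((integrable_const a).indicator hs.compl)
          (hint.inf (integrable_const a)) fun ω => ?_
        refine Set.indicator_apply_le' (fun hω => ?_) fun _ => le_min (hnonneg ω) ha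
        exact le_min (hat.trans (le_of_not_ge hω)) le_rfl

/-- If each `C i` satisfies the `(ε,δ)`-lower deviation inequality and
`R ≤ (1-ε) Z`, then the mean-weighted allocation has utilization `U(v) ≥ (1-δ) R`. -/
theorem meanWeighted_utilization_lowR
    {Ω : Type*} [MeasureSpace Ω] [IsProbabilityMeasure (ℙ : Measure Ω)]
    {K : ℕ} (hK : 0 < K)
    (C : Fin K → Ω → ℝ)
    (hmeas : ∀ i, Measurable (C i))
    (hint : ∀ i, Integrable (C i))
    (hnonneg : ∀ i, ∀ ω, 0 ≤ C i ω)
    (μ : Fin K → ℝ) (hμ : ∀ i, μ i = ∫ ω, C i ω) (hμpos : ∀ i, 0 < μ i)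
    (ε δ : ℝ) (hε0 : 0 < ε) (hε1 : ε < 1) (hδ0 : 0 < δ) (hδ1 : δ < 1)
    (hLD : ∀ i, (ℙ {ω | C i ω ≤ (1 - ε) * μ i}).toReal ≤ δ)
    (R : ℝ) (hR : 0 < R)
    (Z : ℝ) (hZ : Z = ∑ i, μ i)
    (hRZ : R ≤ (1 - ε) * Z)
    (v : Fin K → ℝ) (hv : ∀ i, v i = R * μ i / Z) :
    (1 - δ) * R ≤ ∑ i, ∫ ω, min (C i ω) (v i) := by
  have hZpos : 0 < Z := by
    rw [hZ]
    exact Finset.sum_pos (fun i _ => hμpos i) ⟨⟨0, hK⟩, Finset.mem_univ _⟩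
  have hvsum : ∑ i, v i = R := by
    simp_rw [hv]
    rw [← Finset.sum_div, ← Finset.mul_sum, ← hZ, mul_div_cancel_right₀ _ hZpos.ne']
  rw [← hvsum, Finset.mul_sum]
  refine Finset.sum_le_sum fun i _ => ?_
  refine one_sub_mul_le_integral_min (hmeas i) (hint i) (hnonneg i) ?_ ?_ (hLD i)
  · rw [hv]
    have := hμpos i
    positivity
  · rw [hv, div_le_iff₀ hZpos, mul_right_comm]
    exact mul_le_mul_of_nonneg_right hRZ (hμpos i).le
end

section
/- Suppose each C_i satisfies the (ε,δ)-lower deviation inequality, where ε + δ ≤ 1/2, and let α be such that ε + δ ≤ α. Then the Price of Fairness at level α is at most 1 + 2α; concretely, the mean-weighted allocation v = (R·μ_1/Z, …, R·μ_K/Z) satisfies Σ_i v_i = R, is α-fair (Q(v) ≤ α), and for every allocation w with w_i ≥ 0 and Σ_i w_i = R it holds that U(w) ≤ (1 + 2α)·U(v). -/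
open MeasureTheory ProbabilityTheory

/-- A nonnegative random variable truncated at `b` has mean at least `a` times the probability
that it exceeds `c`, for any nonnegative `a ≤ b, c`. -/
lemma mul_one_sub_le_integral_min_s11 {Ω : Type*} [MeasurableSpace Ω] {P : Measure Ω}
    [IsProbabilityMeasure P] {X : Ω → ℝ} (hX : Measurable X) (hXi : Integrable X P)
    (hX0 : ∀ ω, 0 ≤ X ω) {a b c d : ℝ} (ha : 0 ≤ a) (hab : a ≤ b) (hac : a ≤ c)
    (hd : (P {ω | X ω ≤ c}).toReal ≤ d) :
    a * (1 - d) ≤ ∫ ω, min (X ω) b ∂P := by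
  have hs : MeasurableSet {ω | X ω ≤ c} := measurableSet_le hX measurable_const
  have hcompl : P.real {ω | X ω ≤ c}ᶜ = 1 - P.real {ω | X ω ≤ c} := probReal_compl_eq_one_sub hs
  calc a * (1 - d) ≤ a * P.real {ω | X ω ≤ c}ᶜ := by
        rw [hcompl]
        exact mul_le_mul_of_nonneg_left (sub_le_sub_left hd 1) ha
    _ = ∫ ω, ({ω | X ω ≤ c}ᶜ).indicator (fun _ => a) ω ∂P := by
        rw [integral_indicator_const a hs.compl, smul_eq_mul, mul_comm]
    _ ≤ ∫ ω, min (X ω) b ∂P := by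
        refine integral_mono ((integrable_const a).indicator hs.compl)
          (hXi.inf (integrable_const b)) fun ω => ?_
        by_cases h : X ω ≤ c
        · simpa [h] using ⟨hX0 ω, ha.trans hab⟩
        · simpa [h] using ⟨hac.trans (not_le.mp h).le, hab⟩

lemma integral_min_const_le_left {Ω : Type*} [MeasurableSpace Ω] {P : Measure Ω}
    [IsProbabilityMeasure P] {X : Ω → ℝ} (hXi : Integrable X P) (b : ℝ) :
    ∫ ω, min (X ω) b ∂P ≤ ∫ ω, X ω ∂P :=
  integral_mono (hXi.inf (integrable_const b)) hXi fun _ => min_le_left _ _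

lemma integral_min_const_le_right {Ω : Type*} [MeasurableSpace Ω] {P : Measure Ω}
    [IsProbabilityMeasure P] {X : Ω → ℝ} (hXi : Integrable X P) (b : ℝ) :
    ∫ ω, min (X ω) b ∂P ≤ b := by
  have h : ∫ ω, min (X ω) b ∂P ≤ ∫ _, b ∂P :=
    integral_mono (hXi.inf (integrable_const b)) (integrable_const b) fun _ => min_le_right _ _
  simpa using h

/-- If each `C i` satisfies the `(ε,δ)`-lower deviation inequality with
`ε + δ ≤ 1/2`, and `ε + δ ≤ α`, then the mean-weighted allocation `v i = R * μ i / Z`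
sums to `R`, is `α`-fair, and every allocation `w` with `w i ≥ 0` and `∑ i, w i = R`
has utilization `U(w) ≤ (1 + 2α) * U(v)`; in particular the Price of Fairness at level `α`
is at most `1 + 2α`. -/
theorem meanWeighted_PoF_linear
    {Ω : Type*} [MeasureSpace Ω] [IsProbabilityMeasure (ℙ : Measure Ω)]
    {K : ℕ} (hK : 0 < K)
    (C : Fin K → Ω → ℝ)
    (hmeas : ∀ i, Measurable (C i))
    (hint : ∀ i, Integrable (C i))
    (hnonneg : ∀ i, ∀ ω, 0 ≤ C i ω)
    (μ : Fin K → ℝ) (hμ : ∀ i, μ i = ∫ ω, C i ω) (hμpos : ∀ i, 0 < μ i)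
    (ε δ : ℝ) (hε0 : 0 < ε) (hε1 : ε < 1) (hδ0 : 0 < δ) (hδ1 : δ < 1)
    (hεδ : ε + δ ≤ 1 / 2)
    (hLD : ∀ i, (ℙ {ω | C i ω ≤ (1 - ε) * μ i}).toReal ≤ δ)
    (α : ℝ) (hα : ε + δ ≤ α)
    (R : ℝ) (hR : 0 < R)
    (Z : ℝ) (hZ : Z = ∑ i, μ i)
    (v : Fin K → ℝ) (hv : ∀ i, v i = R * μ i / Z) :
    (∑ i, v i = R) ∧
    (∀ i j, |(∫ ω, min (C i ω) (v i)) / μ i - (∫ ω, min (C j ω) (v j)) / μ j| ≤ α) ∧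
    (∀ w : Fin K → ℝ, (∀ i, 0 ≤ w i) → ∑ i, w i = R →
      (∑ i, ∫ ω, min (C i ω) (w i)) ≤ (1 + 2 * α) * (∑ i, ∫ ω, min (C i ω) (v i))) := by
  have : Nonempty (Fin K) := ⟨⟨0, hK⟩⟩
  have hZpos : 0 < Z := hZ ▸ Finset.sum_pos (fun i _ => hμpos i) Finset.univ_nonempty
  set m : ℝ := min (R / Z) 1 with hm
  have hm0 : 0 ≤ m := le_min (by positivity) zero_le_one
  have hm1 : m ≤ 1 := min_le_right _ _
  have hmR : m ≤ R / Z := min_le_left _ _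
  have hvt : ∀ i, v i = R / Z * μ i := fun i => by rw [hv]; ring
  have hupper : ∀ i, ∫ ω, min (C i ω) (v i) ≤ m * μ i := fun i => by
    rw [hm, min_mul_of_nonneg _ _ (hμpos i).le, ← hvt, one_mul]
    exact le_min (integral_min_const_le_right (hint i) _)
      (hμ i ▸ integral_min_const_le_left (hint i) _)
  have hlower : ∀ i, (1 - (ε + δ)) * m * μ i ≤ ∫ ω, min (C i ω) (v i) := fun i => by
    have hmμ : 0 ≤ m * μ i := mul_nonneg hm0 (hμpos i).le
    have h := mul_one_sub_le_integral_min_s11 (a := (1 - ε) * (m * μ i)) (b := v i) (hmeas i) (hint i)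
      (hnonneg i) (mul_nonneg (by linarith) hmμ)
      (by rw [hvt]; nlinarith [mul_le_mul_of_nonneg_right hmR (hμpos i).le])
      (mul_le_mul_of_nonneg_left (by nlinarith [hμpos i]) (by linarith)) (hLD i)
    nlinarith [mul_nonneg (mul_pos hε0 hδ0).le hmμ]
  refine ⟨?_, fun i j => ?_, fun w _ hw => ?_⟩
  · simp_rw [hvt]
    rw [← Finset.mul_sum, ← hZ, div_mul_cancel₀ R hZpos.ne']
  · have hq_le : ∀ i, (∫ ω, min (C i ω) (v i)) / μ i ≤ m := fun i =>
      (div_le_iff₀ (hμpos i)).2 (hupper i)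
    have hle_q : ∀ i, (1 - (ε + δ)) * m ≤ (∫ ω, min (C i ω) (v i)) / μ i := fun i =>
      (le_div_iff₀ (hμpos i)).2 (hlower i)
    have hgap : (ε + δ) * m ≤ ε + δ := mul_le_of_le_one_right (by linarith) hm1
    rw [abs_sub_le_iff]
    constructor <;> linarith [hq_le i, hq_le j, hle_q i, hle_q j]
  · have hUw : ∑ i, ∫ ω, min (C i ω) (w i) ≤ m * Z := by
      rw [hm, min_mul_of_nonneg _ _ hZpos.le, div_mul_cancel₀ R hZpos.ne', one_mul]
      refine le_min (hw ▸ ?_) (hZ ▸ ?_)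
      · exact Finset.sum_le_sum fun i _ => integral_min_const_le_right (hint i) _
      · exact Finset.sum_le_sum fun i _ => hμ i ▸ integral_min_const_le_left (hint i) _
    have hUv : (1 - (ε + δ)) * (m * Z) ≤ ∑ i, ∫ ω, min (C i ω) (v i) := by
      rw [← mul_assoc, hZ, Finset.mul_sum]
      exact Finset.sum_le_sum fun i _ => hlower i
    have hfactor : 1 ≤ (1 + 2 * α) * (1 - (ε + δ)) := by nlinarith
    calc ∑ i, ∫ ω, min (C i ω) (w i) ≤ m * Z := hUw
      _ ≤ (1 + 2 * α) * (1 - (ε + δ)) * (m * Z) :=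
        le_mul_of_one_le_left (mul_nonneg hm0 hZpos.le) hfactor
      _ = (1 + 2 * α) * ((1 - (ε + δ)) * (m * Z)) := mul_assoc _ _ _
      _ ≤ (1 + 2 * α) * ∑ i, ∫ ω, min (C i ω) (v i) :=
        mul_le_mul_of_nonneg_left hUv (by linarith)
end

section
/- Suppose each C_i satisfies the (ε,δ)-lower deviation inequality with ε + δ ≤ min(α, 1/2) for some α ∈ (0, 1). Then for any total resource R > 0, the mean-weighted allocation v = (R·μ_1/Z, …, R·μ_K/Z) is α-fair (Q(v) ≤ α) and achieves utilization U(v) ≥ (1−α)·min(R, Z), i.e., at least a (1−α) fraction of the maximum utilization. -/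
open MeasureTheory ProbabilityTheory

/-- A nonnegative random variable exceeding `a` with probability at least `1 - δ` has
truncated mean at least `(1 - δ) * min a v`. -/
theorem mul_min_le_integral_min {Ω : Type*} [MeasurableSpace Ω] {P : Measure Ω}
    [IsProbabilityMeasure P] {X : Ω → ℝ} (hX : Measurable X) (hint : Integrable X P)
    (hnonneg : ∀ ω, 0 ≤ X ω) {a v δ : ℝ} (ha : 0 ≤ a) (hv : 0 ≤ v)
    (hdev : P.real {ω | X ω ≤ a} ≤ δ) :
    (1 - δ) * min a v ≤ ∫ ω, min (X ω) v ∂P := by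
  have hmarkov := mul_meas_ge_le_integral_of_nonneg
    (Filter.Eventually.of_forall fun ω => le_min (hnonneg ω) hv)
    (hint.inf (integrable_const v)) (min a v)
  have hcompl : P.real {ω | X ω ≤ a}ᶜ = 1 - P.real {ω | X ω ≤ a} :=
    probReal_compl_eq_one_sub (measurableSet_le hX measurable_const)
  have hsub : P.real {ω | X ω ≤ a}ᶜ ≤ P.real {ω | min a v ≤ min (X ω) v} :=
    measureReal_mono fun ω hω => min_le_min_right v (le_of_not_ge hω)
  calc (1 - δ) * min a v ≤ P.real {ω | min a v ≤ min (X ω) v} * min a v :=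
        mul_le_mul_of_nonneg_right (by linarith) (le_min ha hv)
    _ ≤ _ := by rw [mul_comm]; exact hmarkov

/-- If each `C i` satisfies the `(ε,δ)`-lower deviation inequality with
`ε + δ ≤ min α (1/2)` for some `α ∈ (0,1)`, then for any `R > 0` the mean-weighted
allocation is `α`-fair and achieves utilization at least `(1-α) * min R Z`, a `(1-α)`
fraction of the maximum utilization. -/
theorem meanWeighted_fair_and_efficient
    {Ω : Type*} [MeasureSpace Ω] [IsProbabilityMeasure (ℙ : Measure Ω)]
    {K : ℕ} (hK : 0 < K)
    (C : Fin K → Ω → ℝ)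
    (hmeas : ∀ i, Measurable (C i))
    (hint : ∀ i, Integrable (C i))
    (hnonneg : ∀ i, ∀ ω, 0 ≤ C i ω)
    (μ : Fin K → ℝ) (hμ : ∀ i, μ i = ∫ ω, C i ω) (hμpos : ∀ i, 0 < μ i)
    (ε δ : ℝ) (hε0 : 0 < ε) (hε1 : ε < 1) (hδ0 : 0 < δ) (hδ1 : δ < 1)
    (α : ℝ) (hα0 : 0 < α) (hα1 : α < 1)
    (hεδ : ε + δ ≤ min α (1 / 2))
    (hLD : ∀ i, (ℙ {ω | C i ω ≤ (1 - ε) * μ i}).toReal ≤ δ)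
    (R : ℝ) (hR : 0 < R)
    (Z : ℝ) (hZ : Z = ∑ i, μ i)
    (v : Fin K → ℝ) (hv : ∀ i, v i = R * μ i / Z) :
    (∀ i j, |(∫ ω, min (C i ω) (v i)) / μ i - (∫ ω, min (C j ω) (v j)) / μ j| ≤ α) ∧
    (1 - α) * min R Z ≤ ∑ i, ∫ ω, min (C i ω) (v i) := by
  have : NeZero K := ⟨hK.ne'⟩
  have hZ0 : 0 < Z := hZ ▸ Finset.sum_pos (fun i _ => hμpos i) Finset.univ_nonempty
  set t := R / Z with ht
  have ht0 : 0 < t := div_pos hR hZ0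
  have hvt : ∀ i, v i = t * μ i := fun i => by rw [hv, ht]; ring
  have hεδα : ε + δ ≤ α := hεδ.trans (min_le_left _ _)
  have hm0 : 0 ≤ min t 1 := le_min ht0.le zero_le_one
  have hfactor : (1 - α) * min t 1 ≤ (1 - δ) * min (1 - ε) t := by
    rcases le_total (1 - ε) t with h | h
    · rw [min_eq_left h]
      have : (1 - α) * min t 1 ≤ (1 - α) * 1 :=
        mul_le_mul_of_nonneg_left (min_le_right _ _) (by linarith)
      nlinarith [mul_pos hε0 hδ0]
    · rw [min_eq_right h]
      have : (1 - α) * min t 1 ≤ (1 - α) * t :=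
        mul_le_mul_of_nonneg_left (min_le_left _ _) (by linarith)
      nlinarith
  have hlower : ∀ i, (1 - α) * min t 1 * μ i ≤ ∫ ω, min (C i ω) (v i) := fun i => by
    have hvi : 0 ≤ v i := by rw [hvt]; exact (mul_pos ht0 (hμpos i)).le
    have h := mul_min_le_integral_min (hmeas i) (hint i) (hnonneg i)
      (mul_nonneg (by linarith) (hμpos i).le) hvi (hLD i)
    refine le_trans ?_ h
    rw [hvt, ← min_mul_of_nonneg _ _ (hμpos i).le, ← mul_assoc]
    exact mul_le_mul_of_nonneg_right hfactor (hμpos i).le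
  have hupper : ∀ i, ∫ ω, min (C i ω) (v i) ≤ min t 1 * μ i := fun i => by
    have hmin : Integrable fun ω => min (C i ω) (v i) := (hint i).inf (integrable_const _)
    rw [min_mul_of_nonneg _ _ (hμpos i).le, one_mul]
    refine le_min ?_ ?_
    · have h := integral_mono hmin (integrable_const (v i)) fun ω => min_le_right _ _
      simpa [hvt] using h
    · rw [hμ]
      exact integral_mono hmin (hint i) fun ω => min_le_left _ _
  refine ⟨fun i j => ?_, ?_⟩
  · have hi₁ := (le_div_iff₀ (hμpos i)).2 (hlower i)
    have hi₂ := (div_le_iff₀ (hμpos i)).2 (hupper i)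
    have hj₁ := (le_div_iff₀ (hμpos j)).2 (hlower j)
    have hj₂ := (div_le_iff₀ (hμpos j)).2 (hupper j)
    have hα : α * min t 1 ≤ α := mul_le_of_le_one_right hα0.le (min_le_right _ _)
    rw [abs_le]
    constructor <;> linarith
  · have hRZ : min R Z = min t 1 * Z := by
      rw [min_mul_of_nonneg _ _ hZ0.le, one_mul, ht, div_mul_cancel₀ _ hZ0.ne']
    calc (1 - α) * min R Z = ∑ i, (1 - α) * min t 1 * μ i := by
          rw [← Finset.mul_sum, ← hZ, hRZ, mul_assoc]
      _ ≤ _ := Finset.sum_le_sum fun i _ => hlower i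
end
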